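/- arXiv:1609.01458 — 4 statements merged into one kernel-verified Lean document; each statement's English description precedes it below -/
import Mathlib

section
/- (Lemma 1, Characterization.) Assume that the specification K and its prefix closure cl(K) are conditionally decomposable with respect to (Σ₁, Σ₂, Σ_k). Let M₁ be a language over Σ₁ ∪ Σ_k and M₂ a language over Σ₂ ∪ Σ_k such that, for i = 1, 2, cl(M_i) ⊆ L_i ∥ L_k and cl(M_i) is controllable with respect to L_i ∥ L_k and Σ_{i+k,u}. Then M₁ ∥ M₂ = K and cl(M₁) ∥ cl(M₂) = cl(K) hold if and only if M₁ ∥ P_k(M₂) = P_{1+k}(K), M₂ ∥ P_k(M₁) = P_{2+k}(K), and M₁ and M₂ are synchronously nonconflicting. -/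
namespace CoordControl

variable {α : Type*}

/-- Natural projection onto subalphabet `A`: erase all letters outside `A`. -/
noncomputable def proj (A : Set α) (w : List α) : List α :=
  w.filter fun a => @decide (a ∈ A) (Classical.dec _)

/-- Projection of a language. -/
noncomputable def projL (A : Set α) (L : Set (List α)) : Set (List α) :=
  proj A '' L

/-- A word is over alphabet `A`. -/
def WordOver (A : Set α) (w : List α) : Prop := ∀ a ∈ w, a ∈ A

/-- A language is over alphabet `A`. -/
def LangOver (A : Set α) (L : Set (List α)) : Prop := ∀ w ∈ L, WordOver A w

/-- Synchronous product of `L₁` over `A₁` and `L₂` over `A₂`. -/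
def sync (A₁ A₂ : Set α) (L₁ L₂ : Set (List α)) : Set (List α) :=
  {w | WordOver (A₁ ∪ A₂) w ∧ proj A₁ w ∈ L₁ ∧ proj A₂ w ∈ L₂}

/-- Prefix closure. -/
def cl (L : Set (List α)) : Set (List α) := {w | ∃ u, w ++ u ∈ L}

/-- A language is prefix-closed if it equals its prefix closure. -/
def PrefixClosed (L : Set (List α)) : Prop := L = cl L

/-- `K` is controllable with respect to `L` and the uncontrollable events `U`. -/
def Controllable (K L : Set (List α)) (U : Set α) : Prop :=
  ∀ w ∈ cl K, ∀ a ∈ U, w ++ [a] ∈ L → w ++ [a] ∈ cl K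

/-- Supremal controllable sublanguage of `K` w.r.t. `L` and `U`. -/
def supC (K L : Set (List α)) (U : Set α) : Set (List α) :=
  ⋃₀ {M | M ⊆ K ∧ Controllable M L U}

/-- Infimal prefix-closed controllable superlanguage of `K` w.r.t. `L` and `U`. -/
def infC (K L : Set (List α)) (U : Set α) : Set (List α) :=
  ⋂₀ {M | K ⊆ M ∧ PrefixClosed M ∧ Controllable M L U}

/-- `M` over `A₁` and `N` over `A₂` are synchronously nonconflicting. -/
def Nonconflicting (A₁ A₂ : Set α) (M N : Set (List α)) : Prop :=
  cl (sync A₁ A₂ M N) = sync A₁ A₂ (cl M) (cl N)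

/-- The natural projection onto `A` is an `L`-observer. -/
def Observer (A : Set α) (L : Set (List α)) : Prop :=
  ∀ t ∈ projL A L, ∀ s ∈ cl L, proj A s <+: t →
    ∃ u, s ++ u ∈ L ∧ proj A (s ++ u) = t

/-- The natural projection onto `A` is locally control consistent (LCC) for `L`,
with uncontrollable events `U`. -/
def LCC (A U : Set α) (L : Set (List α)) : Prop :=
  ∀ s ∈ cl L, ∀ σ ∈ U ∩ A,
    (∃ u, WordOver Aᶜ u ∧ s ++ u ++ [σ] ∈ cl L) →
    ∃ u', WordOver (Aᶜ ∩ U) u' ∧ s ++ u' ++ [σ] ∈ cl L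

/-- The coordinator `L_k = P_k(L₁) ∥ P_k(L₂)`. -/
noncomputable def coord (Ek : Set α) (L₁ L₂ : Set (List α)) : Set (List α) :=
  sync Ek Ek (projL Ek L₁) (projL Ek L₂)

/-- `K` is conditionally decomposable w.r.t. `(E₁, E₂, Ek)`. -/
noncomputable def CondDecomposable (E₁ E₂ Ek : Set α) (K : Set (List α)) : Prop :=
  K = sync (E₁ ∪ Ek) (E₂ ∪ Ek) (projL (E₁ ∪ Ek) K) (projL (E₂ ∪ Ek) K)

/-- A pair `(M₁, M₂)` is a solution of Problem 1 for the specification `K`: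
`M₁` is over `E₁ ∪ Ek`, `M₂` over `E₂ ∪ Ek`, `cl Mᵢ ⊆ Lᵢ ∥ L_k`, `cl Mᵢ` is
controllable w.r.t. `Lᵢ ∥ L_k` and `Σ_{i+k,u}`, and `M₁ ∥ M₂ = K`,
`cl M₁ ∥ cl M₂ = cl K`. -/
noncomputable def IsSolution (E₁ E₂ Ek U : Set α) (L₁ L₂ K M₁ M₂ : Set (List α)) : Prop :=
  LangOver (E₁ ∪ Ek) M₁ ∧ LangOver (E₂ ∪ Ek) M₂ ∧
  cl M₁ ⊆ sync E₁ Ek L₁ (coord Ek L₁ L₂) ∧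
  cl M₂ ⊆ sync E₂ Ek L₂ (coord Ek L₁ L₂) ∧
  Controllable (cl M₁) (sync E₁ Ek L₁ (coord Ek L₁ L₂)) ((E₁ ∪ Ek) ∩ U) ∧
  Controllable (cl M₂) (sync E₂ Ek L₂ (coord Ek L₁ L₂)) ((E₂ ∪ Ek) ∩ U) ∧
  sync (E₁ ∪ Ek) (E₂ ∪ Ek) M₁ M₂ = K ∧
  sync (E₁ ∪ Ek) (E₂ ∪ Ek) (cl M₁) (cl M₂) = cl K

/-- `M` is relaxed conditionally controllable w.r.t. plants `L₁`, `L₂` and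
coordinator `Lk`. -/
noncomputable def RelaxedCC (E₁ E₂ Ek U : Set α) (L₁ L₂ Lk M : Set (List α)) : Prop :=
  Controllable (projL (E₁ ∪ Ek) M) (sync E₁ Ek L₁ Lk) ((E₁ ∪ Ek) ∩ U) ∧
  Controllable (projL (E₂ ∪ Ek) M) (sync E₂ Ek L₂ Lk) ((E₂ ∪ Ek) ∩ U)

/-- `M` is conditionally controllable (original framework) w.r.t. plants `L₁`, `L₂`
and coordinator `Lk`. -/
noncomputable def CondControllable (E₁ E₂ Ek U : Set α) (L₁ L₂ Lk M : Set (List α)) : Prop :=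
  Controllable (projL Ek M) Lk (Ek ∩ U) ∧
  Controllable (projL (E₁ ∪ Ek) M) (sync E₁ Ek L₁ (cl (projL Ek M))) ((E₁ ∪ Ek) ∩ U) ∧
  Controllable (projL (E₂ ∪ Ek) M) (sync E₂ Ek L₂ (cl (projL Ek M))) ((E₂ ∪ Ek) ∩ U)

theorem proj_nil (A : Set α) : proj A [] = [] := rfl

theorem proj_append (A : Set α) (u v : List α) : proj A (u ++ v) = proj A u ++ proj A v := by
  simp [proj]

theorem proj_cons_of_mem {A : Set α} {a : α} (h : a ∈ A) (w : List α) :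
    proj A (a :: w) = a :: proj A w := by
  simp [proj, h]

theorem proj_cons_of_notMem {A : Set α} {a : α} (h : a ∉ A) (w : List α) :
    proj A (a :: w) = proj A w := by
  simp [proj, h]

theorem proj_eq_self {A : Set α} {w : List α} (h : WordOver A w) : proj A w = w := by
  simpa [proj, List.filter_eq_self, WordOver] using h

theorem proj_eq_nil {A : Set α} {w : List α} (h : ∀ a ∈ w, a ∉ A) : proj A w = [] := by
  simpa [proj, List.filter_eq_nil_iff] using h

theorem wordOver_proj (A : Set α) (w : List α) : WordOver A (proj A w) := by
  intro a ha
  simp only [proj, List.mem_filter, decide_eq_true_eq] at ha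
  exact ha.2

theorem proj_proj_of_subset {A B : Set α} (h : A ⊆ B) (w : List α) :
    proj A (proj B w) = proj A w := by
  simp only [proj, List.filter_filter]
  refine List.filter_congr fun a _ => ?_
  by_cases ha : a ∈ A
  · simp [ha, h ha]
  · simp [ha]

/-- Two words that agree on the common letters have a common interleaving. -/
theorem exists_proj_eq_of_proj_inter_eq {A B : Set α} {u v : List α}
    (hu : WordOver A u) (hv : WordOver B v) (h : proj (A ∩ B) u = proj (A ∩ B) v) :
    ∃ w, WordOver (A ∪ B) w ∧ proj A w = u ∧ proj B w = v := by
  induction u generalizing v with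
  | nil =>
    refine ⟨v, fun a ha => Or.inr (hv a ha), proj_eq_nil fun a ha haA => ?_, proj_eq_self hv⟩
    have hmem : a ∈ proj (A ∩ B) v := by simp [proj, ha, haA, hv a ha]
    simp [← h, proj_nil] at hmem
  | cons a u ih =>
    have haA : a ∈ A := hu a (by simp)
    have hu' : WordOver A u := fun b hb => hu b (by simp [hb])
    by_cases haB : a ∈ B
    · rw [proj_cons_of_mem (show a ∈ A ∩ B from ⟨haA, haB⟩)] at h
      obtain ⟨v₁, v₂, rfl, hv₁, -, hv₂⟩ := List.filter_eq_cons_iff.1 h.symm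
      have hv₁B : WordOver B v₁ := fun b hb => hv b (by simp [hb])
      obtain ⟨w, hw, hwA, hwB⟩ :=
        ih hu' (fun b hb => hv b (by simp [hb]) : WordOver B v₂) hv₂.symm
      refine ⟨v₁ ++ a :: w, fun b hb => ?_, ?_, ?_⟩
      · rcases List.mem_append.1 hb with hb | hb
        · exact Or.inr (hv₁B b hb)
        · rcases List.mem_cons.1 hb with rfl | hb
          · exact Or.inl haA
          · exact hw b hb
      · have hnil : proj A v₁ = [] := proj_eq_nil fun b hb hbA =>
          hv₁ b hb (by simp [hbA, hv₁B b hb])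
        rw [proj_append, hnil, proj_cons_of_mem haA, hwA, List.nil_append]
      · rw [proj_append, proj_eq_self hv₁B, proj_cons_of_mem haB, hwB]
    · rw [proj_cons_of_notMem fun h' => haB h'.2] at h
      obtain ⟨w, hw, hwA, hwB⟩ := ih hu' hv h
      refine ⟨a :: w, fun b hb => ?_, ?_, ?_⟩
      · rcases List.mem_cons.1 hb with rfl | hb
        · exact Or.inl haA
        · exact hw b hb
      · rw [proj_cons_of_mem haA, hwA]
      · rw [proj_cons_of_notMem haB, hwB]

theorem sync_comm (A B : Set α) (M N : Set (List α)) : sync A B M N = sync B A N M := by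
  ext w
  simp only [sync, Set.mem_ofPred_eq, Set.union_comm A B, and_comm (a := proj A w ∈ M)]

theorem proj_mem_sync {A B : Set α} {M N : Set (List α)} {w : List α} (hw : w ∈ sync A B M N) :
    proj A w ∈ sync A (A ∩ B) M (projL (A ∩ B) N) := by
  refine ⟨fun a ha => Or.inl (wordOver_proj A w a ha), ?_, proj B w, hw.2.2, ?_⟩
  · rw [proj_eq_self (wordOver_proj A w)]
    exact hw.2.1
  · rw [proj_proj_of_subset Set.inter_subset_right, proj_proj_of_subset Set.inter_subset_left]

theorem projL_sync {A B : Set α} {M N : Set (List α)} (hN : LangOver B N) :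
    projL A (sync A B M N) = sync A (A ∩ B) M (projL (A ∩ B) N) := by
  ext u
  constructor
  · rintro ⟨w, hw, rfl⟩
    exact proj_mem_sync hw
  · rintro ⟨hu, huM, v, hv, hvu⟩
    have huA : WordOver A u := fun a ha => (hu a ha).elim id fun h => h.1
    rw [proj_eq_self huA] at huM
    obtain ⟨w, hw, hwA, hwB⟩ := exists_proj_eq_of_proj_inter_eq huA (hN v hv) hvu.symm
    exact ⟨w, ⟨hw, hwA ▸ huM, hwB ▸ hv⟩, hwA⟩

theorem sync_subset_left {A B : Set α} {M N : Set (List α)} (hBA : B ⊆ A) :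
    sync A B M N ⊆ M := by
  rintro u ⟨hu, huM, -⟩
  rwa [proj_eq_self fun a ha => (hu a ha).elim id fun h => hBA h] at huM

/-- Lemma 1 (Characterization). -/
theorem lemma1_characterization
    (E₁ E₂ Ek U : Set α)
    (hUniv : E₁ ∪ E₂ = (Set.univ : Set α))
    (hInter : E₁ ∩ E₂ ⊆ Ek) (hSub : Ek ⊆ E₁ ∪ E₂)
    (L₁ L₂ Lm1 Lm2 : Set (List α))
    (hO1 : LangOver E₁ L₁) (hO2 : LangOver E₂ L₂)
    (hP1 : PrefixClosed L₁) (hP2 : PrefixClosed L₂)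
    (hm1 : Lm1 ⊆ L₁) (hm2 : Lm2 ⊆ L₂)
    (hc1 : cl Lm1 = L₁) (hc2 : cl Lm2 = L₂)
    (K : Set (List α))
    (hK : K ⊆ sync E₁ E₂ Lm1 Lm2)
    (hCD : CondDecomposable E₁ E₂ Ek K)
    (hCDcl : CondDecomposable E₁ E₂ Ek (cl K))
    (M₁ M₂ : Set (List α))
    (hM1o : LangOver (E₁ ∪ Ek) M₁) (hM2o : LangOver (E₂ ∪ Ek) M₂)
    (hM1sub : cl M₁ ⊆ sync E₁ Ek L₁ (coord Ek L₁ L₂))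
    (hM2sub : cl M₂ ⊆ sync E₂ Ek L₂ (coord Ek L₁ L₂))
    (hM1c : Controllable (cl M₁) (sync E₁ Ek L₁ (coord Ek L₁ L₂)) ((E₁ ∪ Ek) ∩ U))
    (hM2c : Controllable (cl M₂) (sync E₂ Ek L₂ (coord Ek L₁ L₂)) ((E₂ ∪ Ek) ∩ U)) :
    (sync (E₁ ∪ Ek) (E₂ ∪ Ek) M₁ M₂ = K ∧
     sync (E₁ ∪ Ek) (E₂ ∪ Ek) (cl M₁) (cl M₂) = cl K) ↔
    (sync (E₁ ∪ Ek) Ek M₁ (projL Ek M₂) = projL (E₁ ∪ Ek) K ∧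
     sync (E₂ ∪ Ek) Ek M₂ (projL Ek M₁) = projL (E₂ ∪ Ek) K ∧
     Nonconflicting (E₁ ∪ Ek) (E₂ ∪ Ek) M₁ M₂) := by
  have hEk : (E₁ ∪ Ek) ∩ (E₂ ∪ Ek) = Ek := by
    rw [← Set.inter_union_distrib_right, Set.union_eq_right.2 hInter]
  have hEk' : (E₂ ∪ Ek) ∩ (E₁ ∪ Ek) = Ek := by rw [Set.inter_comm, hEk]
  have h₁ := projL_sync (A := E₁ ∪ Ek) (M := M₁) hM2o
  have h₂ := projL_sync (A := E₂ ∪ Ek) (M := M₂) hM1o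
  rw [hEk] at h₁
  rw [hEk', sync_comm (E₂ ∪ Ek)] at h₂
  constructor
  · rintro ⟨hsync, hcl⟩
    rw [hsync] at h₁ h₂
    exact ⟨h₁.symm, h₂.symm, by rw [Nonconflicting, hsync, hcl]⟩
  · rintro ⟨hK₁, hK₂, hnc⟩
    have hsync : sync (E₁ ∪ Ek) (E₂ ∪ Ek) M₁ M₂ = K := by
      rw [hK₁] at h₁
      rw [hK₂] at h₂
      apply Set.Subset.antisymm
      · intro w hw
        rw [hCD]
        exact ⟨hw.1, h₁ ▸ ⟨w, hw, rfl⟩, h₂ ▸ ⟨w, hw, rfl⟩⟩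
      · intro w hw
        have hover : WordOver ((E₁ ∪ Ek) ∪ (E₂ ∪ Ek)) w := (hCD ▸ hw).1
        have hw₁ : proj (E₁ ∪ Ek) w ∈ projL (E₁ ∪ Ek) K := ⟨w, hw, rfl⟩
        have hw₂ : proj (E₂ ∪ Ek) w ∈ projL (E₂ ∪ Ek) K := ⟨w, hw, rfl⟩
        rw [← hK₁] at hw₁
        rw [← hK₂] at hw₂
        exact ⟨hover, sync_subset_left Set.subset_union_right hw₁,
          sync_subset_left Set.subset_union_right hw₂⟩
    exact ⟨hsync, by rw [← hsync]; exact hnc.symm⟩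

end CoordControl
end

section
/- (Theorem 2.) Assume K ⊆ L_{m,1} ∥ L_{m,2} and that both K and its prefix closure cl(K) are conditionally decomposable with respect to (Σ₁, Σ₂, Σ_k). Then there exists a solution of Problem 1 for the specification K if and only if there exists a solution of Problem 1 for its prefix closure cl(K). -/
namespace CoordControl

variable {α : Type*}

theorem subset_cl (L : Set (List α)) : L ⊆ cl L := fun w hw => ⟨[], by simpa using hw⟩

theorem cl_mono {L M : Set (List α)} (h : L ⊆ M) : cl L ⊆ cl M :=
  fun _ ⟨u, hu⟩ => ⟨u, h hu⟩

theorem cl_cl (L : Set (List α)) : cl (cl L) = cl L :=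
  Set.Subset.antisymm (fun _ ⟨u, v, h⟩ => ⟨u ++ v, by rwa [← List.append_assoc]⟩) (subset_cl _)

theorem LangOver.cl {A : Set α} {L : Set (List α)} (h : LangOver A L) : LangOver A (cl L) :=
  fun _ ⟨_, hu⟩ a ha => h _ hu a (List.mem_append_left _ ha)

theorem langOver_projL (A : Set α) (L : Set (List α)) : LangOver A (projL A L) := by
  rintro _ ⟨w, _, rfl⟩ a ha
  simpa using (List.mem_filter.mp ha).2

theorem projL_mono (A : Set α) {L M : Set (List α)} (h : L ⊆ M) : projL A L ⊆ projL A M :=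
  Set.image_mono h

theorem projL_cl_subset (A : Set α) (L : Set (List α)) : projL A (cl L) ⊆ cl (projL A L) := by
  rintro _ ⟨w, ⟨u, hu⟩, rfl⟩
  exact ⟨proj A u, w ++ u, hu, List.filter_append ..⟩

/-- The language with closure `cl M` whose words in `projL A (cl K)` are those of `projL A K`. -/
noncomputable def markedRefinement (A : Set α) (K M : Set (List α)) : Set (List α) :=
  projL A K ∪ (cl M \ projL A (cl K))

theorem LangOver.markedRefinement {A : Set α} {M : Set (List α)} (h : LangOver A M)
    (K : Set (List α)) : LangOver A (markedRefinement A K M) :=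
  fun w hw => hw.elim (langOver_projL A K w) fun hw => h.cl w hw.1

theorem cl_markedRefinement {A : Set α} {K M : Set (List α)} (h : projL A (cl K) ⊆ cl M) :
    cl (markedRefinement A K M) = cl M := by
  refine Set.Subset.antisymm ?_ fun w hw => ?_
  · rw [← cl_cl M]
    exact cl_mono (Set.union_subset ((projL_mono A (subset_cl K)).trans h) Set.sdiff_subset)
  · by_cases hwK : w ∈ projL A (cl K)
    · exact cl_mono Set.subset_union_left (projL_cl_subset A K hwK)
    · exact subset_cl _ (Or.inr ⟨hw, hwK⟩)

theorem mem_projL_of_mem_markedRefinement {A : Set α} {K M : Set (List α)} {w : List α}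
    (hw : w ∈ cl K) (h : proj A w ∈ markedRefinement A K M) : proj A w ∈ projL A K :=
  h.resolve_right fun h => h.2 ⟨w, hw, rfl⟩

theorem sync_mono {A B : Set α} {L L' M M' : Set (List α)} (hL : L ⊆ L') (hM : M ⊆ M') :
    sync A B L M ⊆ sync A B L' M' :=
  fun _ ⟨h, h₁, h₂⟩ => ⟨h, hL h₁, hM h₂⟩

theorem projL_subset_left {A B : Set α} {K L M : Set (List α)} (h : K ⊆ sync A B L M) :
    projL A K ⊆ L := by
  rintro _ ⟨w, hw, rfl⟩
  exact (h hw).2.1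

theorem projL_subset_right {A B : Set α} {K L M : Set (List α)} (h : K ⊆ sync A B L M) :
    projL B K ⊆ M := by
  rintro _ ⟨w, hw, rfl⟩
  exact (h hw).2.2

theorem sync_markedRefinement {A B : Set α} {K M N : Set (List α)}
    (hK : K = sync A B (projL A K) (projL B K)) (hMN : sync A B (cl M) (cl N) = cl K) :
    sync A B (markedRefinement A K M) (markedRefinement B K N) = K := by
  have hM := projL_subset_left hMN.ge
  have hN := projL_subset_right hMN.ge
  refine Set.Subset.antisymm (fun w hw => ?_) ?_
  · have hwK : w ∈ cl K := hMN.le <| sync_mono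
      ((subset_cl _).trans (cl_markedRefinement hM).le)
      ((subset_cl _).trans (cl_markedRefinement hN).le) hw
    exact hK.ge ⟨hw.1, mem_projL_of_mem_markedRefinement hwK hw.2.1,
      mem_projL_of_mem_markedRefinement hwK hw.2.2⟩
  · exact hK.le.trans (sync_mono Set.subset_union_left Set.subset_union_left)

/-- Theorem 2: a solution for K exists iff a solution for cl(K) exists. -/
theorem thm2_solution_iff_solution_closure
    (E₁ E₂ Ek U : Set α)
    (hUniv : E₁ ∪ E₂ = (Set.univ : Set α))
    (hInter : E₁ ∩ E₂ ⊆ Ek) (hSub : Ek ⊆ E₁ ∪ E₂)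
    (L₁ L₂ Lm1 Lm2 : Set (List α))
    (hO1 : LangOver E₁ L₁) (hO2 : LangOver E₂ L₂)
    (hP1 : PrefixClosed L₁) (hP2 : PrefixClosed L₂)
    (hm1 : Lm1 ⊆ L₁) (hm2 : Lm2 ⊆ L₂)
    (hc1 : cl Lm1 = L₁) (hc2 : cl Lm2 = L₂)
    (K : Set (List α))
    (hK : K ⊆ sync E₁ E₂ Lm1 Lm2)
    (hCD : CondDecomposable E₁ E₂ Ek K)
    (hCDcl : CondDecomposable E₁ E₂ Ek (cl K)) :
    (∃ M₁ M₂ : Set (List α), IsSolution E₁ E₂ Ek U L₁ L₂ K M₁ M₂) ↔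
    (∃ M₁ M₂ : Set (List α), IsSolution E₁ E₂ Ek U L₁ L₂ (cl K) M₁ M₂) := by
  constructor
  · rintro ⟨M₁, M₂, hA₁, hA₂, hs₁, hs₂, hu₁, hu₂, -, hM⟩
    refine ⟨cl M₁, cl M₂, hA₁.cl, hA₂.cl, ?_⟩
    simp only [cl_cl]
    exact ⟨hs₁, hs₂, hu₁, hu₂, hM, hM⟩
  · rintro ⟨M₁, M₂, hA₁, hA₂, hs₁, hs₂, hu₁, hu₂, -, hM⟩
    rw [cl_cl] at hM
    refine ⟨markedRefinement (E₁ ∪ Ek) K M₁, markedRefinement (E₂ ∪ Ek) K M₂,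
      hA₁.markedRefinement K, hA₂.markedRefinement K, ?_⟩
    rw [cl_markedRefinement (projL_subset_left hM.ge), cl_markedRefinement (projL_subset_right hM.ge)]
    exact ⟨hs₁, hs₂, hu₁, hu₂, sync_markedRefinement hCD hM, hM⟩

end CoordControl
end

section
/- (Transitivity of controllability, used in the relaxation argument of Section 4.2.) Let Σ_u ⊆ Σ be a set of uncontrollable events, let L be a prefix-closed language, and let C be a prefix-closed language with C ⊆ L that is controllable with respect to L and Σ_u. Then for every language M with cl(M) ⊆ C, M is controllable with respect to C and Σ_u if and only if M is controllable with respect to L and Σ_u. -/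
namespace CoordControl

variable {α : Type*}

/-- Transitivity of controllability (Section 4.2). -/
theorem controllability_transitivity
    (U : Set α) (L C : Set (List α))
    (hL : PrefixClosed L) (hC : PrefixClosed C) (hCL : C ⊆ L)
    (hCc : Controllable C L U)
    (M : Set (List α)) (hM : cl M ⊆ C) :
    Controllable M C U ↔ Controllable M L U := by
  refine ⟨fun h w hw a ha hwa => h w hw a ha ?_, fun h w hw a ha hwa => h w hw a ha (hCL hwa)⟩
  have hwC : w ∈ cl C := hC ▸ hM hw
  exact hC.symm ▸ hCc w hwC a ha hwa

end CoordControl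
end

section
/- (Marking construction, claim from the proof of the appendix lemma.) Let L be a prefix-closed language and let K ⊆ L. Define M = K ∪ (L \ cl(K)). Then cl(M) = L and M ∩ cl(K) = K. -/
namespace CoordControl

variable {α : Type*}

/-- Marking construction (claim from the proof of the appendix lemma). -/
theorem marking_construction
    (L K : Set (List α))
    (hL : PrefixClosed L) (hKL : K ⊆ L) :
    cl (K ∪ (L \ cl K)) = L ∧ (K ∪ (L \ cl K)) ∩ cl K = K := by
  refine ⟨Set.Subset.antisymm ?_ ?_, Set.Subset.antisymm ?_ ?_⟩
  · rintro w ⟨u, hu⟩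
    rw [hL]
    exact ⟨u, hu.elim (fun h => hKL h) (fun h => h.1)⟩
  · intro w hw
    by_cases h : w ∈ cl K
    · obtain ⟨u, hu⟩ := h
      exact ⟨u, Or.inl hu⟩
    · exact ⟨[], by rw [List.append_nil]; exact Or.inr ⟨hw, h⟩⟩
  · rintro w ⟨hw | hw, hcl⟩
    · exact hw
    · exact absurd hcl hw.2
  · intro w hw
    exact ⟨Or.inl hw, [], by rwa [List.append_nil]⟩

end CoordControl
end
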